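/- Let k₁, k₂, k₃, k₄ > 0 and 0 < c_{A2} ≤ c_{A1} ≤ 1, and let V₁, V₂, c_{B1}, c_{B2} ∈ ℝ satisfy the four steady-state balances c_{A1} − 1 + k₁ c_{A1} V₁ = 0, c_{A2} − c_{A1} + k₂ c_{A2} V₂ = 0, c_{B1} + c_{A1} − 1 + k₃ c_{B1} V₁ = 0, and c_{B2} − c_{B1} + c_{A2} − c_{A1} + k₄ c_{B2} V₂ = 0. Then, setting Υ₁ = k₁ c_{A1} and Υ₂ = k₂ c_{A2}, one has c_{B2} = Υ₂ (Υ₁(1 − c_{A1}) − (Υ₁ + k₃(1 − c_{A1}))(c_{A2} − c_{A1})) / ((Υ₁ + k₃(1 − c_{A1}))(Υ₂ + k₄(c_{A1} − c_{A2}))), both factors of the denominator being strictly positive. -/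

import Mathlib

/-- Closed-form expression of the outlet concentration `c_{B2}` of the reactor
network design problem, obtained by eliminating the equality constraints:
with `Υ₁ = k₁ c_{A1}` and `Υ₂ = k₂ c_{A2}`,
`c_{B2} = Υ₂ (Υ₁(1 − c_{A1}) − (Υ₁ + k₃(1 − c_{A1}))(c_{A2} − c_{A1})) /
((Υ₁ + k₃(1 − c_{A1}))(Υ₂ + k₄(c_{A1} − c_{A2})))`, both factors of the
denominator being strictly positive. -/
theorem reactor_network_cB2_closed_form (k₁ k₂ k₃ k₄ cA1 cA2 V₁ V₂ cB1 cB2 : ℝ)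
    (hk₁ : 0 < k₁) (hk₂ : 0 < k₂) (hk₃ : 0 < k₃) (hk₄ : 0 < k₄)
    (hcA2_pos : 0 < cA2) (hle : cA2 ≤ cA1) (hcA1_le : cA1 ≤ 1)
    (h1 : cA1 - 1 + k₁ * cA1 * V₁ = 0)
    (h2 : cA2 - cA1 + k₂ * cA2 * V₂ = 0)
    (h3 : cB1 + cA1 - 1 + k₃ * cB1 * V₁ = 0)
    (h4 : cB2 - cB1 + cA2 - cA1 + k₄ * cB2 * V₂ = 0) :
    0 < k₁ * cA1 + k₃ * (1 - cA1) ∧ 0 < k₂ * cA2 + k₄ * (cA1 - cA2) ∧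
      cB2 = k₂ * cA2 * (k₁ * cA1 * (1 - cA1) -
              (k₁ * cA1 + k₃ * (1 - cA1)) * (cA2 - cA1)) /
            ((k₁ * cA1 + k₃ * (1 - cA1)) * (k₂ * cA2 + k₄ * (cA1 - cA2))) := by
  have hA1 : 0 < cA1 := lt_of_lt_of_le hcA2_pos hle
  have hs : 0 ≤ 1 - cA1 := by linarith
  have ht : 0 ≤ cA1 - cA2 := by linarith
  have hD1 : 0 < k₁ * cA1 + k₃ * (1 - cA1) :=
    add_pos_of_pos_of_nonneg (mul_pos hk₁ hA1) (mul_nonneg hk₃.le hs)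
  have hD2 : 0 < k₂ * cA2 + k₄ * (cA1 - cA2) :=
    add_pos_of_pos_of_nonneg (mul_pos hk₂ hcA2_pos) (mul_nonneg hk₄.le ht)
  have hB1 : cB1 * (k₁ * cA1 + k₃ * (1 - cA1)) = k₁ * cA1 * (1 - cA1) := by
    linear_combination k₁ * cA1 * h3 - k₃ * cB1 * h1
  have hB2 : cB2 * (k₂ * cA2 + k₄ * (cA1 - cA2)) = k₂ * cA2 * (cB1 - cA2 + cA1) := by
    linear_combination k₂ * cA2 * h4 - k₄ * cB2 * h2
  refine ⟨hD1, hD2, ?_⟩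
  rw [eq_div_iff (mul_pos hD1 hD2).ne']
  linear_combination (k₁ * cA1 + k₃ * (1 - cA1)) * hB2 + k₂ * cA2 * hB1
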